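/- arXiv:2506.15021 — 4 statements merged into one kernel-verified Lean document; each statement's English description precedes it below -/
import Mathlib

section
/- Let Θ be a nonempty set, let L_CE, L₁, L₀ : Θ → ℝ be real-valued functions, let λ ∈ ℝ with 0 < λ < 1, and define the worst-group loss L_worst(θ) = max(L₁(θ), L₀(θ)) and the group objective L_GO(θ) = (1−λ)·L_CE(θ) + λ·L_worst(θ). If θ̂ ∈ Θ minimizes L_GO over Θ and θ_avg ∈ Θ minimizes L_CE over Θ, then both group losses of θ̂ are controlled by the worst-group loss of θ_avg: L₁(θ̂) ≤ max(L₁(θ_avg), L₀(θ_avg)) and L₀(θ̂) ≤ max(L₁(θ_avg), L₀(θ_avg)). -/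
/-- with `L_worst θ = max (L₁ θ) (L₀ θ)` and
`L_GO θ = (1−λ)·L_CE θ + λ·L_worst θ`, `0 < λ < 1`: if θ̂ minimizes `L_GO`
over Θ and θ_avg minimizes `L_CE` over Θ, then both group losses of θ̂ are
bounded by the worst-group loss of θ_avg. -/
theorem sft_go_both_groups_controlled
    {Θ : Type*} [Nonempty Θ]
    (L_CE L₁ L₀ L_worst L_GO : Θ → ℝ)
    (lam : ℝ) (hlam0 : 0 < lam) (hlam1 : lam < 1)
    (hworst : ∀ θ, L_worst θ = max (L₁ θ) (L₀ θ))
    (hGO : ∀ θ, L_GO θ = (1 - lam) * L_CE θ + lam * L_worst θ)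
    (θhat θavg : Θ)
    (hhat : ∀ θ : Θ, L_GO θhat ≤ L_GO θ)
    (havg : ∀ θ : Θ, L_CE θavg ≤ L_CE θ) :
    L₁ θhat ≤ max (L₁ θavg) (L₀ θavg) ∧ L₀ θhat ≤ max (L₁ θavg) (L₀ θavg) := by
  have hle : L_worst θhat ≤ L_worst θavg := by
    have hmin := hhat θavg
    rw [hGO, hGO] at hmin
    have hCE := mul_le_mul_of_nonneg_left (havg θhat) (sub_nonneg.2 hlam1.le)
    exact le_of_mul_le_mul_left (by linarith) hlam0
  rw [hworst, hworst] at hle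
  exact max_le_iff.1 hle
end

section
/- Let E be a real inner product space, C ⊆ E a convex set, L : E → ℝ, θ ∈ C, θ* ∈ C, g ∈ E, and η > 0 a real number. Suppose (i) g is a subgradient of L at θ relative to C, i.e., L(y) ≥ L(θ) + ⟨g, y − θ⟩ for all y ∈ C, and (ii) p ∈ C is the metric projection of θ − η·g onto C, i.e., ⟨(θ − η·g) − p, c − p⟩ ≤ 0 for all c ∈ C. Then L(θ) − L(θ*) ≤ (‖θ − θ*‖² − ‖p − θ*‖²)/(2η) + (η/2)·‖g‖². -/
open RealInnerProductSpace

/-- If `⟪x - p, c - p⟫ ≤ 0`, then `p` is at least as close to `c` as `x` is. -/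
theorem norm_sub_sq_le_of_inner_sub_nonpos
    {E : Type*} [NormedAddCommGroup E] [InnerProductSpace ℝ E] {x p c : E}
    (h : ⟪x - p, c - p⟫ ≤ 0) : ‖p - c‖ ^ 2 ≤ ‖x - c‖ ^ 2 := by
  have hsq := norm_sub_sq_real (x - p) (c - p)
  rw [sub_sub_sub_cancel_right, norm_sub_rev c p] at hsq
  nlinarith [sq_nonneg ‖x - p‖]

/-- one-step suboptimality bound for projected subgradient descent.
If `g` is a subgradient of `L` at `θ` relative to the convex set `C`, and
`p ∈ C` is the metric projection of `θ - η•g` onto `C`, `η > 0`, then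
`L θ − L θ* ≤ (‖θ − θ*‖² − ‖p − θ*‖²)/(2η) + (η/2)‖g‖²`. -/
theorem projected_subgradient_one_step
    {E : Type*} [NormedAddCommGroup E] [InnerProductSpace ℝ E]
    (C : Set E) (hC : Convex ℝ C)
    (L : E → ℝ)
    (θ θs : E) (hθ : θ ∈ C) (hθs : θs ∈ C)
    (g : E) (η : ℝ) (hη : 0 < η)
    (hsub : ∀ y ∈ C, L θ + ⟪g, y - θ⟫ ≤ L y)
    (p : E) (hp : p ∈ C)
    (hproj : ∀ c ∈ C, ⟪(θ - η • g) - p, c - p⟫ ≤ 0) :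
    L θ - L θs ≤ (‖θ - θs‖ ^ 2 - ‖p - θs‖ ^ 2) / (2 * η) + (η / 2) * ‖g‖ ^ 2 := by
  have hg := hsub θs hθs
  have hdist := norm_sub_sq_le_of_inner_sub_nonpos (hproj θs hθs)
  rw [sub_right_comm, norm_sub_sq_real (θ - θs), norm_smul, mul_pow, Real.norm_eq_abs, sq_abs,
    real_inner_smul_right, real_inner_comm g] at hdist
  rw [← neg_sub θ θs, inner_neg_right] at hg
  have hinner : ⟪g, θ - θs⟫ ≤
      (‖θ - θs‖ ^ 2 - ‖p - θs‖ ^ 2) / (2 * η) + (η / 2) * ‖g‖ ^ 2 := by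
    rw [← sub_le_iff_le_add, le_div_iff₀ (by positivity)]
    linarith
  linarith
end

section
/- Let E be a real inner product space, C ⊆ E a convex set, L : E → ℝ, θ* ∈ C, and B > 0, G > 0 real constants. Let T be a positive integer and set the step size η = B/(G·√T). Let θ¹, …, θ^{T+1} ∈ C and g¹, …, g^T ∈ E satisfy, for each t = 1, …, T: (i) θ^{t+1} is the metric projection of θ^t − η·g^t onto C (i.e., ⟨(θ^t − η·g^t) − θ^{t+1}, c − θ^{t+1}⟩ ≤ 0 for all c ∈ C); (ii) g^t is a subgradient of L at θ^t relative to C (i.e., L(y) ≥ L(θ^t) + ⟨g^t, y − θ^t⟩ for all y ∈ C); and (iii) ‖g^t‖ ≤ G. Assume ‖θ¹ − θ*‖ ≤ B. Then ∑_{t=1}^{T} (L(θ^t) − L(θ*)) ≤ B·G·√T. -/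
open RealInnerProductSpace

/-- The one-step progress inequality of projected subgradient descent. -/
theorem projected_subgradient_step
    {E : Type*} [NormedAddCommGroup E] [InnerProductSpace ℝ E]
    {L : E → ℝ} {x p c g : E} {η G : ℝ} (hη : 0 ≤ η)
    (hproj : ⟪(x - η • g) - p, c - p⟫ ≤ 0)
    (hsub : L x + ⟪g, c - x⟫ ≤ L c) (hg : ‖g‖ ≤ G) :
    2 * η * (L x - L c) ≤ ‖x - c‖ ^ 2 - ‖p - c‖ ^ 2 + η ^ 2 * G ^ 2 := by
  have hp := norm_sub_sq_le_of_inner_sub_nonpos hproj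
  have hx : x - η • g - c = (x - c) - η • g := by abel
  rw [hx, norm_sub_sq_real (x - c), real_inner_smul_right, norm_smul, mul_pow, Real.norm_eq_abs,
    sq_abs, real_inner_comm] at hp
  rw [← neg_sub x c, inner_neg_right] at hsub
  have hgap : η * (L x - L c) ≤ η * ⟪g, x - c⟫ :=
    mul_le_mul_of_nonneg_left (by linarith) hη
  have hsq : η ^ 2 * ‖g‖ ^ 2 ≤ η ^ 2 * G ^ 2 := by gcongr
  linarith

/-- The excess loss of projected subgradient descent with an arbitrary constant step size. -/
theorem projected_subgradient_sum_le
    {E : Type*} [NormedAddCommGroup E] [InnerProductSpace ℝ E]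
    {L : E → ℝ} {c : E} {η G : ℝ} (hη : 0 ≤ η) {θ g : ℕ → E} (T : ℕ)
    (hproj : ∀ t ∈ Finset.Icc 1 T, ⟪(θ t - η • g t) - θ (t + 1), c - θ (t + 1)⟫ ≤ 0)
    (hsub : ∀ t ∈ Finset.Icc 1 T, L (θ t) + ⟪g t, c - θ t⟫ ≤ L c)
    (hg : ∀ t ∈ Finset.Icc 1 T, ‖g t‖ ≤ G) :
    2 * η * ∑ t ∈ Finset.Icc 1 T, (L (θ t) - L c) ≤
      ‖θ 1 - c‖ ^ 2 - ‖θ (T + 1) - c‖ ^ 2 + T * (η ^ 2 * G ^ 2) := by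
  induction T with
  | zero => simp
  | succ n ih =>
    have hsubset : Finset.Icc 1 n ⊆ Finset.Icc 1 (n + 1) :=
      Finset.Icc_subset_Icc_right n.le_succ
    have hlast : n + 1 ∈ Finset.Icc 1 (n + 1) := by simp
    have hn := ih (fun t ht => hproj t (hsubset ht)) (fun t ht => hsub t (hsubset ht))
      (fun t ht => hg t (hsubset ht))
    have hstep := projected_subgradient_step hη (hproj _ hlast) (hsub _ hlast) (hg _ hlast)
    rw [Finset.sum_Icc_succ_top (Nat.le_add_left 1 n), mul_add]
    push_cast
    linarith

/-- projected subgradient descent with the tuned step size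
`η = B/(G·√T)`: total excess loss bound `∑_{t=1}^T (L θᵗ − L θ*) ≤ B·G·√T`. -/
theorem projected_subgradient_total_excess_loss_tuned
    {E : Type*} [NormedAddCommGroup E] [InnerProductSpace ℝ E]
    (C : Set E) (hC : Convex ℝ C)
    (L : E → ℝ) (θs : E) (hθs : θs ∈ C)
    (B G : ℝ) (hB : 0 < B) (hG : 0 < G)
    (T : ℕ) (hT : 0 < T)
    (η : ℝ) (hηdef : η = B / (G * Real.sqrt T))
    (θ : ℕ → E) (g : ℕ → E)
    (hmem : ∀ t ∈ Finset.Icc 1 (T + 1), θ t ∈ C)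
    (hproj : ∀ t ∈ Finset.Icc 1 T,
      ∀ c ∈ C, ⟪(θ t - η • g t) - θ (t + 1), c - θ (t + 1)⟫ ≤ 0)
    (hsub : ∀ t ∈ Finset.Icc 1 T, ∀ y ∈ C, L (θ t) + ⟪g t, y - θ t⟫ ≤ L y)
    (hgbound : ∀ t ∈ Finset.Icc 1 T, ‖g t‖ ≤ G)
    (hinit : ‖θ 1 - θs‖ ≤ B) :
    ∑ t ∈ Finset.Icc 1 T, (L (θ t) - L θs) ≤ B * G * Real.sqrt T := by
  have hT' : 0 < Real.sqrt T := Real.sqrt_pos.2 (Nat.cast_pos.2 hT)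
  have hη : 0 < η := hηdef ▸ div_pos hB (mul_pos hG hT')
  have hηB : η * (G * Real.sqrt T) = B := by
    rw [hηdef, div_mul_cancel₀ _ (mul_pos hG hT').ne']
  have hsum := projected_subgradient_sum_le hη.le T
    (fun t ht => hproj t ht θs hθs) (fun t ht => hsub t ht θs hθs) hgbound
  have hnoise : (T : ℝ) * (η ^ 2 * G ^ 2) = B ^ 2 := by
    rw [← hηB, mul_pow, mul_pow, Real.sq_sqrt (Nat.cast_nonneg T)]
    ring
  have hstart : ‖θ 1 - θs‖ ^ 2 ≤ B ^ 2 := by gcongr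
  have hbudget : 2 * η * (B * G * Real.sqrt T) = 2 * B ^ 2 := by
    linear_combination 2 * B * hηB
  refine le_of_mul_le_mul_left ?_ (mul_pos two_pos hη)
  linarith [sq_nonneg ‖θ (T + 1) - θs‖]
end

section
/- Let E be a real inner product space, C ⊆ E a convex set, and L : E → ℝ a function that is convex on C. Suppose θ* ∈ C minimizes L over C, i.e., L(θ*) ≤ L(θ) for all θ ∈ C. Let B > 0 and G > 0 be real constants, let T be a positive integer, set η = B/(G·√T), and let θ¹, …, θ^{T+1} ∈ C and g¹, …, g^T ∈ E satisfy, for each t = 1, …, T: (i) θ^{t+1} is the metric projection of θ^t − η·g^t onto C (i.e., ⟨(θ^t − η·g^t) − θ^{t+1}, c − θ^{t+1}⟩ ≤ 0 for all c ∈ C); (ii) g^t is a subgradient of L at θ^t relative to C (i.e., L(y) ≥ L(θ^t) + ⟨g^t, y − θ^t⟩ for all y ∈ C); and (iii) ‖g^t‖ ≤ G. Assume ‖θ − θ'‖ ≤ B for all θ, θ' ∈ C. Then the excess error of the average iterate θ̄ = (1/T)·∑_{t=1}^{T} θ^t after T iterations satisfies ε_T := L(θ̄) − min over C of L = L(θ̄)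 − L(θ*) ≤ B·G/√T; in particular the excess error converges to the global optimum at rate O(1/√T). -/
open RealInnerProductSpace

/-- One step of projected descent: moving from `x` along `-η • g` and projecting to `p`
decreases the squared distance to any point `c` of the constraint set. -/
lemma two_mul_inner_le_of_projected_step {E : Type*} [NormedAddCommGroup E]
    [InnerProductSpace ℝ E] {x g p c : E} {η : ℝ}
    (h : ⟪(x - η • g) - p, c - p⟫ ≤ 0) :
    2 * η * ⟪g, x - c⟫ ≤ ‖x - c‖ ^ 2 - ‖p - c‖ ^ 2 + η ^ 2 * ‖g‖ ^ 2 := by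
  have hpyth : ‖p - c‖ ^ 2 ≤ ‖(x - c) - η • g‖ ^ 2 := by
    have hsplit : (x - c) - η • g = ((x - η • g) - p) - (c - p) := by abel
    rw [hsplit, norm_sub_sq_real ((x - η • g) - p), norm_sub_rev p c]
    nlinarith [sq_nonneg ‖(x - η • g) - p‖]
  rw [norm_sub_sq_real (x - c), inner_smul_right, real_inner_comm, norm_smul, mul_pow,
    Real.norm_eq_abs, sq_abs] at hpyth
  linarith

/-- The regret bound for projected subgradient descent with a constant step size. -/
lemma two_mul_regret_le_of_projected_subgradient {E : Type*} [NormedAddCommGroup E]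
    [InnerProductSpace ℝ E] {C : Set E} {L : E → ℝ} {c : E} (hc : c ∈ C) {G η : ℝ}
    (hη : 0 ≤ η) {T : ℕ} {θ g : ℕ → E}
    (hproj : ∀ t ∈ Finset.Icc 1 T,
      ∀ c ∈ C, ⟪(θ t - η • g t) - θ (t + 1), c - θ (t + 1)⟫ ≤ 0)
    (hsub : ∀ t ∈ Finset.Icc 1 T, ∀ y ∈ C, L (θ t) + ⟪g t, y - θ t⟫ ≤ L y)
    (hgbound : ∀ t ∈ Finset.Icc 1 T, ‖g t‖ ≤ G) :
    2 * η * ∑ t ∈ Finset.Icc 1 T, (L (θ t) - L c) ≤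
      ‖θ 1 - c‖ ^ 2 - ‖θ (T + 1) - c‖ ^ 2 + T * (η ^ 2 * G ^ 2) := by
  induction T with
  | zero => simp
  | succ n ih =>
    have hsubset : Finset.Icc 1 n ⊆ Finset.Icc 1 (n + 1) :=
      Finset.Icc_subset_Icc_right n.le_succ
    have hprev := ih (fun t ht => hproj t (hsubset ht)) (fun t ht => hsub t (hsubset ht))
      (fun t ht => hgbound t (hsubset ht))
    have hlast : n + 1 ∈ Finset.Icc 1 (n + 1) := by simp
    have hstep := two_mul_inner_le_of_projected_step (hproj _ hlast c hc)
    have hgap : L (θ (n + 1)) - L c ≤ ⟪g (n + 1), θ (n + 1) - c⟫ := by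
      have := hsub _ hlast c hc
      rw [← neg_sub (θ (n + 1)) c, inner_neg_right] at this
      linarith
    have hgap' := mul_le_mul_of_nonneg_left hgap (by positivity : 0 ≤ 2 * η)
    have hg : η ^ 2 * ‖g (n + 1)‖ ^ 2 ≤ η ^ 2 * G ^ 2 := by
      gcongr
      exact hgbound _ hlast
    rw [Finset.sum_Icc_succ_top (by omega), mul_add]
    push_cast
    linarith

/-- deterministic form of the paper's convergence guarantee.
For `L` convex on a convex set `C` of diameter at most `B`, with `θ*`
minimizing `L` over `C`, projected subgradient descent with step size
`η = B/(G·√T)` and subgradient norms bounded by `G` makes the excess error of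
the average iterate `θ̄ = (1/T)·∑_{t=1}^T θᵗ` satisfy
`L θ̄ − L θ* ≤ B·G/√T`, i.e. an `O(1/√T)` rate to the global optimum. -/
theorem projected_subgradient_excess_error_rate
    {E : Type*} [NormedAddCommGroup E] [InnerProductSpace ℝ E]
    (C : Set E) (hC : Convex ℝ C)
    (L : E → ℝ) (hL : ConvexOn ℝ C L)
    (θs : E) (hθs : θs ∈ C)
    (hmin : ∀ θ ∈ C, L θs ≤ L θ)
    (B G : ℝ) (hB : 0 < B) (hG : 0 < G)
    (T : ℕ) (hT : 0 < T)
    (η : ℝ) (hηdef : η = B / (G * Real.sqrt T))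
    (θ : ℕ → E) (g : ℕ → E)
    (hmem : ∀ t ∈ Finset.Icc 1 (T + 1), θ t ∈ C)
    (hproj : ∀ t ∈ Finset.Icc 1 T,
      ∀ c ∈ C, ⟪(θ t - η • g t) - θ (t + 1), c - θ (t + 1)⟫ ≤ 0)
    (hsub : ∀ t ∈ Finset.Icc 1 T, ∀ y ∈ C, L (θ t) + ⟪g t, y - θ t⟫ ≤ L y)
    (hgbound : ∀ t ∈ Finset.Icc 1 T, ‖g t‖ ≤ G)
    (hdiam : ∀ θ' ∈ C, ∀ θ'' ∈ C, ‖θ' - θ''‖ ≤ B) :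
    L (((1 : ℝ) / T) • ∑ t ∈ Finset.Icc 1 T, θ t) - L θs ≤ B * G / Real.sqrt T := by
  have hT' : (0 : ℝ) < T := Nat.cast_pos.mpr hT
  have hs : 0 < Real.sqrt T := Real.sqrt_pos.mpr hT'
  have hss : Real.sqrt T ^ 2 = T := Real.sq_sqrt hT'.le
  have hη : 0 < η := by rw [hηdef]; positivity
  have hregret := two_mul_regret_le_of_projected_subgradient hθs hη.le hproj hsub hgbound
  have hstart : ‖θ 1 - θs‖ ^ 2 ≤ B ^ 2 := by
    gcongr
    exact hdiam _ (hmem 1 (by simp)) _ hθs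
  have hstep : T * (η ^ 2 * G ^ 2) = B ^ 2 := by
    rw [← hss, hηdef]
    field_simp
  have hjensen : L (((1 : ℝ) / T) • ∑ t ∈ Finset.Icc 1 T, θ t) ≤
      (1 / T) * ∑ t ∈ Finset.Icc 1 T, L (θ t) := by
    rw [Finset.smul_sum, Finset.mul_sum]
    refine hL.map_sum_le (fun _ _ => by positivity) ?_ fun t ht =>
      hmem t (Finset.Icc_subset_Icc_right T.le_succ ht)
    simp [hT'.ne']
  have hsum : ∑ t ∈ Finset.Icc 1 T, (L (θ t) - L θs) ≤ B ^ 2 / η := by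
    rw [le_div_iff₀ hη]
    nlinarith [sq_nonneg ‖θ (T + 1) - θs‖]
  calc L (((1 : ℝ) / T) • ∑ t ∈ Finset.Icc 1 T, θ t) - L θs
      ≤ (1 / T) * ∑ t ∈ Finset.Icc 1 T, L (θ t) - L θs := by gcongr
    _ = (1 / T) * ∑ t ∈ Finset.Icc 1 T, (L (θ t) - L θs) := by
      simp [Finset.sum_sub_distrib, mul_sub, hT'.ne']
    _ ≤ (1 / T) * (B ^ 2 / η) := by gcongr
    _ = B * G / Real.sqrt T := by
      rw [hηdef]
      nth_rewrite 1 [← hss]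
      field_simp
end
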